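/- arXiv:0812.2216 — 2 statements merged into one kernel-verified Lean document; each statement's English description precedes it below -/
import Mathlib

section
/- Let I be an arbitrary set and p ∈ (1,∞). Then ℓ^p(I,ℝ) is of unconditional Banach-Mazur type p; moreover, if I is infinite, then ℓ^p(I,ℝ) is not of Banach-Mazur type q for any q ∈ (p,∞]. -/
open Filter Topology ENNReal

/-- A sequence in a normed space over `ℝ` converges weakly to zero if every continuous linear
functional sends it to a real sequence converging to `0`. -/
def WeaklyNull {X : Type*} [NormedAddCommGroup X] [NormedSpace ℝ X] (x : ℕ → X) : Prop :=
  ∀ f : X →L[ℝ] ℝ, Tendsto (fun n => f (x n)) atTop (𝓝 0)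

/-- `X` is of Banach-Mazur type `p ∈ [1,∞]` (with the convention `N ^ (1/∞) = N ^ 0 = 1`):
every weakly null sequence has a subsequence whose partial sums of the first `N` terms are
bounded by `C * N ^ (1/p)` for some constant `C > 0`. -/
def BMType (X : Type*) [NormedAddCommGroup X] [NormedSpace ℝ X] (p : ℝ≥0∞) : Prop :=
  ∀ x : ℕ → X, WeaklyNull x →
    ∃ n : ℕ → ℕ, StrictMono n ∧ ∃ C : ℝ, 0 < C ∧
      ∀ N : ℕ, ‖∑ k ∈ Finset.range N, x (n k)‖ ≤ C * (N : ℝ) ^ (1 / p).toReal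

/-- `X` is of unconditional Banach-Mazur type `p ∈ [1,∞]`: every weakly null sequence has a
subsequence such that every further subsequence has partial sums bounded by `C * N ^ (1/p)`
for some constant `C > 0` (depending on the further subsequence). -/
def BMUncondType (X : Type*) [NormedAddCommGroup X] [NormedSpace ℝ X] (p : ℝ≥0∞) : Prop :=
  ∀ x : ℕ → X, WeaklyNull x →
    ∃ n : ℕ → ℕ, StrictMono n ∧
      ∀ m : ℕ → ℕ, StrictMono m → ∃ C : ℝ, 0 < C ∧
        ∀ N : ℕ, ‖∑ k ∈ Finset.range N, x (n (m k))‖ ≤ C * (N : ℝ) ^ (1 / p).toReal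

/-- No bound `N ^ b ≤ C * N ^ a` when `a < b`. -/
lemma bm_pow_growth {a b C : ℝ} (hab : a < b)
    (h : ∀ N : ℕ, (N : ℝ) ^ b ≤ C * (N : ℝ) ^ a) : False := by
  have ht : Tendsto (fun N : ℕ => (N : ℝ) ^ (b - a)) atTop atTop :=
    (tendsto_rpow_atTop (sub_pos.2 hab)).comp tendsto_natCast_atTop_atTop
  obtain ⟨N, hN, hN1⟩ := ((ht.eventually_gt_atTop C).and (eventually_ge_atTop 1)).exists
  have hpos : (0 : ℝ) < N := by exact_mod_cast hN1
  have h1 := h N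
  have h2 : (N : ℝ) ^ b = (N : ℝ) ^ (b - a) * (N : ℝ) ^ a := by
    rw [← Real.rpow_add hpos]; ring_nf
  rw [h2] at h1
  have h3 := le_of_mul_le_mul_right h1 (Real.rpow_pos_of_pos hpos a)
  linarith

lemma bm_bounded {X : Type*} [NormedAddCommGroup X] [NormedSpace ℝ X] (x : ℕ → X)
    (hx : WeaklyNull x) : ∃ M : ℝ, 0 ≤ M ∧ ∀ n, ‖x n‖ ≤ M := by
  obtain ⟨M, hM⟩ := banach_steinhaus
    (g := fun n => NormedSpace.inclusionInDoubleDual ℝ X (x n)) (by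
      intro f
      obtain ⟨C, hC⟩ := (hx f).norm.bddAbove_range
      exact ⟨C, fun n => hC ⟨n, rfl⟩⟩)
  have h : ∀ n, ‖x n‖ ≤ M := fun n => by
    have := hM n
    rwa [show ‖NormedSpace.inclusionInDoubleDual ℝ X (x n)‖ = ‖x n‖ from
      (NormedSpace.inclusionInDoubleDualLi ℝ (E := X)).norm_map (x n)] at this
  exact ⟨M, (norm_nonneg _).trans (h 0), h⟩

open Classical in
/-- The key Brezis-Lieb type estimate. -/
lemma bm_key {I : Type*} {p : ℝ≥0∞} [Fact (1 ≤ p)] (hp0 : 0 < p.toReal) (hp' : p ≠ ∞)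
    (x : ℕ → lp (fun _ : I => ℝ) p) (hx : WeaklyNull x) {M : ℝ} (hM0 : 0 ≤ M)
    (hM : ∀ n, ‖x n‖ ≤ M) (u : lp (fun _ : I => ℝ) p) :
    ∀ᶠ n in atTop, ‖u + x n‖ ^ p.toReal ≤ ‖u‖ ^ p.toReal + (M ^ p.toReal + 1) := by
  set r := p.toReal with hr
  set B := ‖u‖ ^ r + M ^ r with hB
  have hB0 : 0 ≤ B := by positivity
  set A := B ^ (1 / r) with hA
  have hA0 : 0 ≤ A := by positivity
  have hAB : A ^ r = B := by
    rw [hA, ← Real.rpow_mul hB0, one_div_mul_cancel hp0.ne', Real.rpow_one]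
  have hcont : Tendsto (fun t : ℝ => (A + t) ^ r) (𝓝 0) (𝓝 B) := by
    have : ContinuousAt (fun t : ℝ => (A + t) ^ r) 0 :=
      ContinuousAt.rpow_const (by fun_prop) (Or.inr hp0.le)
    simpa [ContinuousAt, hAB] using this
  obtain ⟨δ, hδ, hδB⟩ := Metric.eventually_nhds_iff.1
    (hcont.eventually (gt_mem_nhds (lt_add_one B)))
  obtain ⟨s, hs⟩ := ((Metric.tendsto_nhds.1 (lp.hasSum_single hp' u)) (δ / 4)
    (by positivity)).exists
  have ha : Tendsto (fun n => ∑ i ∈ s, (lp.single p i (x n i) : lp (fun _ : I => ℝ) p))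
      atTop (𝓝 0) := by
    rw [← Finset.sum_const_zero (s := s) (M := lp (fun _ : I => ℝ) p)]
    refine tendsto_finsetSum _ fun i _ => ?_
    have h1 := hx (lp.evalCLM ℝ (fun _ : I => ℝ) p i)
    have h2 := (lp.singleContinuousLinearMap ℝ (fun _ : I => ℝ) p i).continuous.tendsto 0
    rw [map_zero] at h2
    exact h2.comp h1
  filter_upwards [(Metric.tendsto_nhds.1 ha) (δ / 4) (by positivity)] with n hn
  set v := ∑ i ∈ s, (lp.single p i (u i) : lp (fun _ : I => ℝ) p) with hv
  set a := ∑ i ∈ s, (lp.single p i (x n i) : lp (fun _ : I => ℝ) p) with hadef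
  have hco : ∀ i ∈ s, (v + (x n - a)) i = u i := by
    intro i hi
    have hsum : ∀ g : I → ℝ, (∑ j ∈ s, (lp.single p j (g j) : lp (fun _ : I => ℝ) p)) i = g i := by
      intro g
      simp only [lp.coeFn_sum, lp.coeFn_single, Finset.sum_apply, Finset.sum_pi_single, if_pos hi]
    rw [lp.coeFn_add, Pi.add_apply, lp.coeFn_sub, Pi.sub_apply, hv, hadef, hsum, hsum]
    ring
  have h1 := lp.norm_compl_sum_single hp0 (v + (x n - a)) s
  have h2 := lp.norm_compl_sum_single hp0 (x n) s
  have h3 : ∑ i ∈ s, (lp.single p i ((v + (x n - a)) i) : lp (fun _ : I => ℝ) p) = v :=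
    Finset.sum_congr rfl fun i hi => by rw [hco i hi]
  have h4 : ∑ i ∈ s, ‖(v + (x n - a)) i‖ ^ r = ∑ i ∈ s, ‖u i‖ ^ r :=
    Finset.sum_congr rfl fun i hi => by rw [hco i hi]
  rw [h3, h4, add_sub_cancel_left, h2] at h1
  have h5 := lp.sum_rpow_le_norm_rpow hp0 u s
  have h6 : ‖x n‖ ^ r ≤ M ^ r := Real.rpow_le_rpow (norm_nonneg _) (hM n) hp0.le
  have h7 : 0 ≤ ∑ i ∈ s, ‖x n i‖ ^ r := Finset.sum_nonneg fun i _ => by positivity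
  have h8 : ‖v + (x n - a)‖ ^ r ≤ B := by linarith
  have h9 : ‖v + (x n - a)‖ ≤ A := by
    rw [hA, one_div]
    exact (Real.le_rpow_inv_iff_of_pos (norm_nonneg _) hB0 hp0).2 h8
  rw [dist_zero_right] at hn
  rw [dist_eq_norm] at hs
  have h10 : ‖u + x n‖ ≤ A + δ / 2 := by
    have e : u + x n = (v + (x n - a)) + (a - (v - u)) := by abel
    rw [e]
    have t1 := norm_add_le (v + (x n - a)) (a - (v - u))
    have t2 := norm_sub_le a (v - u)
    linarith
  have h11 : (A + δ / 2) ^ r < B + 1 := hδB (by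
    rw [dist_zero_right, Real.norm_of_nonneg (by positivity)]; linarith)
  have h12 := Real.rpow_le_rpow (norm_nonneg _) h10 hp0.le
  linarith

lemma bm_uncond {I : Type*} {p : ℝ≥0∞} [Fact (1 ≤ p)] (hp0 : 0 < p.toReal) (hp' : p ≠ ∞) :
    BMUncondType (lp (fun _ : I => ℝ) p) p := by
  intro x hx
  obtain ⟨M, hM0, hM⟩ := bm_bounded x hx
  set K := M ^ p.toReal + 1 with hK
  have hK0 : 0 < K := by positivity
  have hev : ∀ L : ℕ, ∃ n₀, L < n₀ ∧ ∀ n, n₀ ≤ n → ∀ F ∈ (Finset.range (L + 1)).powerset,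
      ‖∑ j ∈ F, x j + x n‖ ^ p.toReal ≤ ‖∑ j ∈ F, x j‖ ^ p.toReal + K := by
    intro L
    have h := (Filter.eventually_all_finset (Finset.range (L + 1)).powerset).2
      fun F _ => bm_key hp0 hp' x hx hM0 hM (∑ j ∈ F, x j)
    obtain ⟨n₀, hn₀⟩ := eventually_atTop.1 h
    exact ⟨max n₀ (L + 1), by omega, fun n hn => hn₀ n (by omega)⟩
  choose φ hφ1 hφ2 using hev
  let n : ℕ → ℕ := fun k => φ^[k + 1] 0
  have hsucc : ∀ k, n (k + 1) = φ (n k) := fun k => Function.iterate_succ_apply' φ (k + 1) 0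
  have hmono : StrictMono n := strictMono_nat_of_lt_succ fun k => by
    rw [hsucc]; exact hφ1 _
  refine ⟨n, hmono, fun m hm => ⟨K ^ (1 / p.toReal), by positivity, fun N => ?_⟩⟩
  have hmain : ∀ N : ℕ, ‖∑ k ∈ Finset.range N, x (n (m k))‖ ^ p.toReal ≤ K * N := by
    intro N
    induction N with
    | zero => simp [Real.zero_rpow hp0.ne']
    | succ N ih =>
      rw [Finset.sum_range_succ]
      have hinj : Function.Injective (fun k => n (m k)) := (hmono.comp hm).injective
      have hF : ∑ j ∈ (Finset.range N).image (fun k => n (m k)), x j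
          = ∑ k ∈ Finset.range N, x (n (m k)) := Finset.sum_image hinj.injOn
      have hstep : ‖∑ k ∈ Finset.range N, x (n (m k)) + x (n (m N))‖ ^ p.toReal
          ≤ ‖∑ k ∈ Finset.range N, x (n (m k))‖ ^ p.toReal + K := by
        rw [← hF]
        cases N with
        | zero =>
          simp only [Finset.range_zero, Finset.image_empty, Finset.sum_empty, zero_add, norm_zero,
            Real.zero_rpow hp0.ne']
          have := Real.rpow_le_rpow (norm_nonneg _) (hM (n (m 0))) hp0.le
          linarith
        | succ N =>
          apply hφ2 (n (m N))
          · rw [← hsucc]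
            exact hmono.monotone (hm N.lt_succ_self)
          · rw [Finset.mem_powerset]
            intro j hj
            obtain ⟨k, hk, rfl⟩ := Finset.mem_image.1 hj
            rw [Finset.mem_range] at hk ⊢
            have := hmono.monotone (hm.monotone (Nat.lt_succ_iff.1 hk))
            omega
      push_cast
      linarith
  rw [ENNReal.toReal_div, ENNReal.toReal_one, ← Real.mul_rpow hK0.le (by positivity), one_div]
  exact (Real.le_rpow_inv_iff_of_pos (norm_nonneg _) (by positivity) hp0).2 (hmain N)

open Classical in
lemma bm_norm_sum {I : Type*} {p : ℝ≥0∞} [Fact (1 ≤ p)] (hp0 : 0 < p.toReal)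
    (σ : I → ℝ) (hσ : ∀ i, ‖σ i‖ = 1) (s : Finset I) :
    ‖∑ i ∈ s, (lp.single p i (σ i) : lp (fun _ : I => ℝ) p)‖ = (s.card : ℝ) ^ (1 / p.toReal) := by
  have h := lp.norm_sum_single hp0 (E := fun _ : I => ℝ) σ s
  simp only [hσ, Real.one_rpow, Finset.sum_const, nsmul_eq_mul, mul_one] at h
  rw [← h, ← Real.rpow_mul (norm_nonneg _), mul_one_div_cancel hp0.ne', Real.rpow_one]

open Classical in
lemma bm_basis_null {I : Type*} {p : ℝ≥0∞} [Fact (1 ≤ p)] (hp1 : 1 < p.toReal)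
    (f : lp (fun _ : I => ℝ) p →L[ℝ] ℝ) :
    Tendsto (fun i => f (lp.single p i 1)) cofinite (𝓝 0) := by
  have hp0 : 0 < p.toReal := by linarith
  rw [Metric.tendsto_nhds]
  intro ε hε
  rw [Filter.eventually_cofinite]
  by_contra hinf
  have hinf : Set.Infinite {i | ¬ dist (f (lp.single p i 1)) 0 < ε} := hinf
  apply bm_pow_growth (a := 1 / p.toReal) (b := 1) (C := ‖f‖ / ε)
    (by rw [div_lt_one hp0]; exact hp1)
  intro N
  obtain ⟨s, hs, hcard⟩ := hinf.exists_subset_card_eq N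
  let σ : I → ℝ := fun i => if 0 ≤ f (lp.single p i 1) then 1 else -1
  have hσ : ∀ i, ‖σ i‖ = 1 := fun i => by
    simp only [σ]; split_ifs <;> simp
  have hf : ∀ i, f (lp.single p i (σ i)) = |f (lp.single p i 1)| := fun i => by
    simp only [σ]
    split_ifs with h
    · rw [abs_of_nonneg h]
    · rw [lp.single_neg, map_neg, abs_of_neg (not_le.1 h)]
  have h1 := f.le_opNorm (∑ i ∈ s, (lp.single p i (σ i) : lp (fun _ : I => ℝ) p))
  rw [bm_norm_sum hp0 σ hσ, hcard, map_sum] at h1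
  simp only [hf] at h1
  have h2 : (N : ℝ) * ε ≤ ∑ i ∈ s, |f (lp.single p i 1)| := by
    rw [← hcard, ← nsmul_eq_mul]
    refine Finset.card_nsmul_le_sum _ _ _ fun i hi => ?_
    have := hs hi
    simpa using this
  have h3 := (h2.trans (le_abs_self _)).trans h1
  rw [Real.rpow_one, div_mul_eq_mul_div, le_div_iff₀ hε]
  exact h3

/-- For an arbitrary index set `I` and `p ∈ (1,∞)`, the space `ℓ^p(I,ℝ)` is of unconditional
Banach-Mazur type `p`; and if `I` is infinite, `ℓ^p(I,ℝ)` is not of Banach-Mazur type `q`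
for any `q ∈ (p,∞]`. -/
theorem bmType_lp_index_set (I : Type*) (p : ℝ≥0∞) [Fact (1 ≤ p)] (hp : 1 < p) (hp' : p < ∞) :
    BMUncondType (lp (fun _ : I => ℝ) p) p ∧
    (Infinite I → ∀ q : ℝ≥0∞, p < q → ¬ BMType (lp (fun _ : I => ℝ) p) q) := by
  classical
  have hp1 : 1 < p.toReal := by
    rw [← ENNReal.toReal_one]
    exact (ENNReal.toReal_lt_toReal ENNReal.one_ne_top hp'.ne).2 hp
  have hp0 : 0 < p.toReal := by linarith
  refine ⟨bm_uncond hp0 hp'.ne, fun hI q hq hT => ?_⟩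
  let e := Infinite.natEmbedding I
  obtain ⟨n, hn, C, hC, h⟩ := hT (fun k => lp.single p (e k) 1) (fun f => by
    have h1 := (bm_basis_null hp1 f).comp e.injective.tendsto_cofinite
    rw [Nat.cofinite_eq_atTop] at h1
    exact h1)
  have hlt : (1 / q).toReal < 1 / p.toReal := by
    rw [← ENNReal.toReal_one, ← ENNReal.toReal_div]
    refine (ENNReal.toReal_lt_toReal ?_ ?_).2 ?_
    · rw [one_div]; exact ENNReal.inv_ne_top.2 (pos_of_gt hq).ne'
    · rw [one_div]; exact ENNReal.inv_ne_top.2 (zero_lt_one.trans hp).ne'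
    · rw [one_div, one_div]; exact ENNReal.inv_lt_inv.2 hq
  refine bm_pow_growth (C := C) hlt fun N => ?_
  refine le_trans (le_of_eq ?_) (h N)
  have h2 := bm_norm_sum hp0 (fun _ : I => (1 : ℝ)) (fun _ => norm_one)
    ((Finset.range N).image fun k => e (n k))
  have hinj : Function.Injective fun k => e (n k) := e.injective.comp hn.injective
  rw [Finset.sum_image hinj.injOn, Finset.card_image_of_injective _ hinj,
    Finset.card_range] at h2
  rw [← h2]
end

section
/- Every infinite-dimensional real inner product space H is of unconditional Banach-Mazur type 2, and is not of Banach-Mazur type q for any q ∈ (2,∞]. -/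
open Filter Topology ENNReal

theorem WeaklyNull.bdd {X : Type*} [NormedAddCommGroup X] [NormedSpace ℝ X] {x : ℕ → X}
    (hx : WeaklyNull x) : ∃ M : ℝ, 0 ≤ M ∧ ∀ n, ‖x n‖ ≤ M := by
  obtain ⟨C, hC⟩ := banach_steinhaus
    (g := fun n => NormedSpace.inclusionInDoubleDual ℝ X (x n)) (by
      intro f
      obtain ⟨C, hC⟩ := (hx f).norm.bddAbove_range
      exact ⟨C, fun n => hC ⟨n, rfl⟩⟩)
  refine ⟨C, (norm_nonneg _).trans (hC 0), fun n => ?_⟩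
  have h := (NormedSpace.inclusionInDoubleDualLi ℝ (E := X)).norm_map (x n)
  rw [← h]
  exact hC n

theorem bmUncond_two (H : Type*) [NormedAddCommGroup H] [InnerProductSpace ℝ H] :
    BMUncondType H 2 := by
  intro x hx
  obtain ⟨M, hM0, hM⟩ := hx.bdd
  have key : ∀ N : ℕ, ∃ G : ℕ, N < G ∧ ∀ l, G ≤ l → ∀ i, i ≤ N →
      |inner ℝ (x i) (x l)| ≤ 1 / ((N : ℝ) + 1) := by
    intro N
    have h1 : ∀ i ∈ Finset.range (N + 1),
        ∀ᶠ l in atTop, |inner ℝ (x i) (x l)| ≤ 1 / ((N : ℝ) + 1) := by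
      intro i _
      have h2 := (hx (innerSL ℝ (x i))).abs
      rw [abs_zero] at h2
      have := h2.eventually_le_const (u := 1 / ((N : ℝ) + 1)) (by positivity)
      simpa using this
    have h3 := (Filter.eventually_all_finset _).2 h1
    obtain ⟨G, hG⟩ := eventually_atTop.1 h3
    refine ⟨max G (N + 1), by omega, fun l hl i hi => hG l (le_trans (le_max_left _ _) hl) i ?_⟩
    simp; omega
  choose G hG1 hG2 using key
  let n : ℕ → ℕ := fun k => G^[k] 0
  have hns : ∀ k, n (k + 1) = G (n k) := fun k => Function.iterate_succ_apply' G k 0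
  have hn : StrictMono n := strictMono_nat_of_lt_succ fun k => by rw [hns]; exact hG1 _
  refine ⟨n, hn, fun m hm => ⟨√(M ^ 2 + 2), by positivity, fun N => ?_⟩⟩
  have hin : ∀ j k, j < k → |inner ℝ (x (n (m j))) (x (n (m k)))| ≤ 1 / (k : ℝ) := by
    intro j k hjk
    obtain ⟨p, hp⟩ : ∃ p, m k = p + 1 := ⟨m k - 1, by have := hm hjk; omega⟩
    have hj : m j ≤ p := by have := hm hjk; omega
    have hk : k ≤ m k := hm.id_le k
    have hpn : p ≤ n p := hn.id_le p
    have h1 := hG2 (n p) (n (m k)) (by rw [hp, hns]) (n (m j)) (hn.monotone hj)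
    refine h1.trans ?_
    have h0 : (0 : ℝ) < k := by exact_mod_cast (by omega : 0 < k)
    apply one_div_le_one_div_of_le h0
    exact_mod_cast (by omega : k ≤ n p + 1)
  have hS : ∀ N : ℕ, ‖∑ k ∈ Finset.range N, x (n (m k))‖ ^ 2 ≤ (M ^ 2 + 2) * N := by
    intro N
    induction N with
    | zero => simp
    | succ N ih =>
      rw [Finset.sum_range_succ, norm_add_sq_real]
      have h1 : inner ℝ (∑ k ∈ Finset.range N, x (n (m k))) (x (n (m N))) ≤ 1 := by
        rw [sum_inner]
        calc _ ≤ ∑ k ∈ Finset.range N, 1 / (N : ℝ) := Finset.sum_le_sum fun j hj =>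
              (le_abs_self _).trans (hin j N (Finset.mem_range.1 hj))
          _ ≤ 1 := by
            simp only [Finset.sum_const, Finset.card_range, nsmul_eq_mul, one_div]
            exact mul_inv_le_one
      have h2 : ‖x (n (m N))‖ ^ 2 ≤ M ^ 2 := pow_le_pow_left₀ (norm_nonneg _) (hM _) 2
      push_cast
      linarith
  have e : ((1 : ℝ≥0∞) / 2).toReal = 1 / 2 := by simp
  rw [e, ← Real.sqrt_eq_rpow, ← Real.sqrt_mul (by positivity)]
  exact Real.le_sqrt_of_sq_le (hS N)

theorem Orthonormal.weaklyNull {H : Type*} [NormedAddCommGroup H] [InnerProductSpace ℝ H]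
    {e : ℕ → H} (he : Orthonormal ℝ e) : WeaklyNull e := by
  intro f
  have hb : ∀ s : Finset ℕ, ∑ i ∈ s, f (e i) ^ 2 ≤ ‖f‖ ^ 2 := by
    intro s
    set A := ∑ i ∈ s, f (e i) ^ 2 with hA
    have hA0 : 0 ≤ A := Finset.sum_nonneg fun i _ => sq_nonneg _
    have h1 : f (∑ i ∈ s, f (e i) • e i) = A := by
      simp [hA, sq]
    have h2 : ‖∑ i ∈ s, f (e i) • e i‖ ^ 2 = A := by
      rw [← real_inner_self_eq_norm_sq, he.inner_sum]
      simp [hA, sq]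
    have h3 := f.le_opNorm (∑ i ∈ s, f (e i) • e i)
    rw [h1, Real.norm_of_nonneg hA0] at h3
    have h4 : A ^ 2 ≤ ‖f‖ ^ 2 * A := by
      rw [← h2] at h3 ⊢
      calc _ ≤ _ := pow_le_pow_left₀ (by positivity) h3 2
        _ = _ := by ring
    by_contra! hc
    nlinarith [sq_nonneg ‖f‖]
  have hs : Summable fun i => f (e i) ^ 2 :=
    summable_of_sum_le (fun i => sq_nonneg _) hb
  have := hs.tendsto_atTop_zero
  have h2 := this.sqrt
  simp only [Real.sqrt_sq_eq_abs, Real.sqrt_zero] at h2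
  exact (tendsto_zero_iff_abs_tendsto_zero _).2 h2

theorem exists_orthonormal_nat (H : Type*) [NormedAddCommGroup H] [InnerProductSpace ℝ H]
    (hdim : ¬ FiniteDimensional ℝ H) : ∃ e : ℕ → H, Orthonormal ℝ e := by
  let b := Module.Basis.ofVectorSpace ℝ H
  have hinf : Infinite (Module.Basis.ofVectorSpaceIndex ℝ H) := by
    by_contra h
    rw [not_infinite_iff_finite] at h
    exact hdim (Module.Finite.of_basis b)
  let g := Infinite.natEmbedding (Module.Basis.ofVectorSpaceIndex ℝ H)
  exact ⟨_, InnerProductSpace.gramSchmidtNormed_orthonormal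
    (b.linearIndependent.comp g g.injective)⟩

/-- Every infinite-dimensional real inner product space is of unconditional Banach-Mazur
type `2`, but not of Banach-Mazur type `q` for any `q ∈ (2,∞]`. -/
theorem bmType_innerProductSpace (H : Type*) [NormedAddCommGroup H] [InnerProductSpace ℝ H]
    (hdim : ¬ FiniteDimensional ℝ H) :
    BMUncondType H 2 ∧ ∀ q : ℝ≥0∞, 2 < q → ¬ BMType H q := by
  refine ⟨bmUncond_two H, fun q hq hT => ?_⟩
  obtain ⟨e, he⟩ := exists_orthonormal_nat H hdim
  obtain ⟨n, hn, C, hC, hb⟩ := hT e he.weaklyNull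
  set s := (1 / q).toReal with hs
  have hs2 : s < 1 / 2 := by
    have h1 : 1 / q < 1 / 2 := by
      simpa using ENNReal.inv_lt_inv.2 hq
    have h2 := (ENNReal.toReal_lt_toReal h1.ne_top (by simp)).2 h1
    simpa [hs] using h2
  have hN : ∀ N : ℕ, (N : ℝ) ^ (1 / 2 : ℝ) ≤ C * (N : ℝ) ^ s := by
    intro N
    refine le_trans (le_of_eq ?_) (hb N)
    have he' := he.comp n hn.injective
    have h2 : ‖∑ k ∈ Finset.range N, e (n k)‖ ^ 2 = N := by
      have := he'.inner_sum (fun _ => (1 : ℝ)) (fun _ => 1) (Finset.range N)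
      rw [← real_inner_self_eq_norm_sq]
      simpa using this
    rw [← Real.sqrt_eq_rpow, ← h2, Real.sqrt_sq (norm_nonneg _)]
  have ht : Tendsto (fun N : ℕ => (N : ℝ) ^ (1 / 2 - s)) atTop atTop :=
    (tendsto_rpow_atTop (by linarith)).comp tendsto_natCast_atTop_atTop
  obtain ⟨N, h1, h2⟩ := ((ht.eventually_gt_atTop C).and (eventually_gt_atTop 0)).exists
  have hp : (0 : ℝ) < N := by exact_mod_cast h2
  rw [Real.rpow_sub hp, lt_div_iff₀ (Real.rpow_pos_of_pos hp _)] at h1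
  exact absurd (hN N) (not_le.2 h1)
end
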